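/- arXiv:1708.05768 — 2 statements merged into one kernel-verified Lean document; each statement's English description precedes it below -/
import Mathlib

section
/- (Theorem 1: invertibility of the difference transform.) Let T be a partition tree on Fin n with structure matrix S and difference transform Δ. Then the data can be recovered from the difference transform: for every y ∈ ℝ^n, Sᵀ(Δ y) = y; equivalently, Sᵀ Δ = I_n as n×n matrices. -/
open Finset Matrix

/-- A partition tree on `Fin n` with `L+1` levels. -/
structure PartitionTree (n L : ℕ) where
  n_pos : 0 < n
  P : Fin (L + 1) → Finset (Finset (Fin n))
  nonempty_mem : ∀ l, ∀ I ∈ P l, I.Nonempty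
  disj : ∀ l, ∀ I ∈ P l, ∀ J ∈ P l, I ≠ J → Disjoint I J
  cover : ∀ l (x : Fin n), ∃ I ∈ P l, x ∈ I
  bottom : P 0 = Finset.univ.image (fun x : Fin n => ({x} : Finset (Fin n)))
  top : P (Fin.last L) = {Finset.univ}
  nested : ∀ l : Fin L, ∀ I ∈ P l.castSucc, ∃ J ∈ P l.succ, I ⊆ J

/-- Index type of the folders of a partition tree: pairs (level, folder). -/
abbrev Folders {n L : ℕ} (T : PartitionTree n L) : Type :=
  (l : Fin (L + 1)) × {I : Finset (Fin n) // I ∈ T.P l}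

/-- Mean of `y` over folder `I`. -/
noncomputable def mval {n : ℕ} (y : Fin n → ℝ) (I : Finset (Fin n)) : ℝ :=
  (∑ x ∈ I, y x) / I.card

/-- A row of the averaging transform, for folder `I`. -/
noncomputable def Mrow {n : ℕ} (I : Finset (Fin n)) (x : Fin n) : ℝ :=
  if x ∈ I then ((I.card : ℝ))⁻¹ else 0

/-- The structure matrix `S`. -/
def Smat {n L : ℕ} (T : PartitionTree n L) : Matrix (Folders T) (Fin n) ℝ :=
  fun i x => if x ∈ i.2.1 then 1 else 0

/-- The averaging transform `M`. -/
noncomputable def Mmat {n L : ℕ} (T : PartitionTree n L) : Matrix (Folders T) (Fin n) ℝ :=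
  fun i x => Mrow i.2.1 x

/-- The diagonal weight matrix `W` with entries `(|I|/n)^β`. -/
noncomputable def Wmat {n L : ℕ} (T : PartitionTree n L) (β : ℝ) :
    Matrix (Folders T) (Folders T) ℝ :=
  Matrix.diagonal (fun i => ((i.2.1.card : ℝ) / n) ^ β)


/-- Theorem 1 (invertibility of the difference transform): `Sᵀ (Δ y) = y` for every
`y ∈ ℝⁿ`; equivalently `Sᵀ Δ = I`. The matrix `Δ` is characterized row-wise: the row
of the root folder equals the corresponding row of `M`, and the row of any non-root
folder equals its `M`-row minus the `M`-row of its parent. -/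
theorem difference_transform_inverse {n L : ℕ} (T : PartitionTree n L)
    (Δ : Matrix (Folders T) (Fin n) ℝ)
    (hΔroot : ∀ (I : Finset (Fin n)) (hI : I ∈ T.P (Fin.last L)) (x : Fin n),
      Δ ⟨Fin.last L, I, hI⟩ x = Mrow I x)
    (hΔ : ∀ (l : Fin L) (I : Finset (Fin n)) (hI : I ∈ T.P l.castSucc)
      (J : Finset (Fin n)), J ∈ T.P l.succ → I ⊆ J → ∀ x : Fin n,
      Δ ⟨l.castSucc, I, hI⟩ x = Mrow I x - Mrow J x) :
    (∀ y : Fin n → ℝ, (Smat T)ᵀ.mulVec (Δ.mulVec y) = y) ∧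
    (Smat T)ᵀ * Δ = 1 := by
  have hmul : (Smat T)ᵀ * Δ = 1 := by
    choose F hF hxF using T.cover
    have huniq : ∀ l x I, I ∈ T.P l → x ∈ I → I = F l x := by
      intro l x I hI hx
      by_contra hne
      exact (Finset.disjoint_left.mp (T.disj l I hI _ (hF l x) hne)) hx (hxF l x)
    ext x z
    have h1 : ((Smat T)ᵀ * Δ) x z = ∑ l, Δ ⟨l, F l x, hF l x⟩ z := by
      rw [Matrix.mul_apply, Fintype.sum_sigma]
      refine Finset.sum_congr rfl fun l _ => ?_
      rw [Finset.sum_eq_single (⟨F l x, hF l x⟩ : {I : Finset (Fin n) // I ∈ T.P l})]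
      · simp [Smat, hxF]
      · rintro ⟨I, hI⟩ _ hne
        have hx : x ∉ I := fun hx => hne (Subtype.ext (huniq l x I hI hx))
        simp [Smat, hx]
      · simp
    have h2 : ∀ l : Fin L, Δ ⟨l.castSucc, F l.castSucc x, hF l.castSucc x⟩ z
        = Mrow (F l.castSucc x) z - Mrow (F l.succ x) z := by
      intro l
      obtain ⟨J, hJ, hIJ⟩ := T.nested l _ (hF l.castSucc x)
      have hJx := huniq l.succ x J hJ (hIJ (hxF _ _))
      exact hΔ l _ _ _ (hF _ _) (hJx ▸ hIJ) z
    have h3 := Fin.sum_univ_castSucc (fun l : Fin (L + 1) => Mrow (F l x) z)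
    rw [Fin.sum_univ_succ] at h3
    have h4 : F 0 x = {x} := by
      refine (huniq 0 x {x} ?_ (by simp)).symm
      rw [T.bottom]
      simp
    rw [h1, Fin.sum_univ_castSucc, hΔroot, Finset.sum_congr rfl (fun l _ => h2 l),
      Finset.sum_sub_distrib]
    have h5 : Mrow (F 0 x) z = (1 : Matrix (Fin n) (Fin n) ℝ) x z := by
      rw [h4, Matrix.one_apply]
      simp [Mrow, eq_comm]
    linarith
  refine ⟨fun y => ?_, hmul⟩
  rw [Matrix.mulVec_mulVec, hmul, Matrix.one_mulVec]
end

section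
/- (Joint-tree reconstruction.) Let T_X be a partition tree on Fin n_X with structure matrix S_X and difference transform Δ_X, and T_Y a partition tree on Fin n_Y with structure matrix S_Y and difference transform Δ_Y. Then every matrix Z ∈ ℝ^{n_X × n_Y} can be recovered from its joint-tree difference transform: Z = S_Xᵀ (Δ_X Z Δ_Yᵀ) S_Y. -/
open Finset Matrix

theorem SmatT_mul_diff {n L : ℕ} (T : PartitionTree n L)
    (D : Matrix (Folders T) (Fin n) ℝ)
    (hroot : ∀ (I : Finset (Fin n)) (hI : I ∈ T.P (Fin.last L)) (x : Fin n),
      D ⟨Fin.last L, I, hI⟩ x = Mrow I x)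
    (hD : ∀ (l : Fin L) (I : Finset (Fin n)) (hI : I ∈ T.P l.castSucc)
      (J : Finset (Fin n)), J ∈ T.P l.succ → I ⊆ J → ∀ x : Fin n,
      D ⟨l.castSucc, I, hI⟩ x = Mrow I x - Mrow J x) :
    (Smat T)ᵀ * D = 1 := by
  ext x y
  choose F hF hxF using fun l => T.cover l x
  have huniq : ∀ l, ∀ I ∈ T.P l, x ∈ I → I = F l := by
    intro l I hI hx
    by_contra hne
    exact Finset.disjoint_left.mp (T.disj l I hI (F l) (hF l) hne) hx (hxF l)
  have hsum : ((Smat T)ᵀ * D) x y = ∑ l, D ⟨l, F l, hF l⟩ y := by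
    rw [Matrix.mul_apply, Fintype.sum_sigma]
    refine Finset.sum_congr rfl fun l _ => ?_
    rw [Finset.sum_eq_single (⟨F l, hF l⟩ : {I : Finset (Fin n) // I ∈ T.P l})]
    · simp [Smat, Matrix.transpose_apply, hxF l]
    · rintro ⟨I, hI⟩ _ hne
      have hx : x ∉ I := fun hx => hne (Subtype.ext (huniq l I hI hx))
      simp [Smat, Matrix.transpose_apply, hx]
    · intro h
      exact absurd (Finset.mem_univ _) h
  have hstep : ∀ l : Fin L, D ⟨l.castSucc, F l.castSucc, hF l.castSucc⟩ y
      = Mrow (F l.castSucc) y - Mrow (F l.succ) y := by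
    intro l
    obtain ⟨J, hJ, hIJ⟩ := T.nested l _ (hF l.castSucc)
    have hJF := huniq _ J hJ (hIJ (hxF _))
    rw [hD l _ _ J hJ hIJ, hJF]
  have h0 : F 0 = {x} := by
    refine (huniq 0 {x} ?_ (Finset.mem_singleton_self x)).symm
    rw [T.bottom]
    simp
  have e1 := Fin.sum_univ_castSucc (fun l : Fin (L + 1) => Mrow (F l) y)
  have e2 := Fin.sum_univ_succ (fun l : Fin (L + 1) => Mrow (F l) y)
  have h1 : Mrow (F 0) y = (1 : Matrix (Fin n) (Fin n) ℝ) x y := by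
    simp [h0, Mrow, Matrix.one_apply, eq_comm]
  rw [hsum, Fin.sum_univ_castSucc, hroot, Finset.sum_congr rfl fun l _ => hstep l,
    Finset.sum_sub_distrib, ← h1]
  linarith

/-- Joint-tree reconstruction: every matrix `Z` is recovered from its joint-tree
difference transform, `Z = S_Xᵀ (Δ_X Z Δ_Yᵀ) S_Y`, where each `Δ` is characterized
row-wise: the row of the root folder equals the corresponding `M`-row, and the row
of a non-root folder equals its `M`-row minus the `M`-row of its parent. -/
theorem joint_tree_reconstruction {nX LX nY LY : ℕ}
    (TX : PartitionTree nX LX) (TY : PartitionTree nY LY)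
    (ΔX : Matrix (Folders TX) (Fin nX) ℝ) (ΔY : Matrix (Folders TY) (Fin nY) ℝ)
    (hΔXroot : ∀ (I : Finset (Fin nX)) (hI : I ∈ TX.P (Fin.last LX)) (x : Fin nX),
      ΔX ⟨Fin.last LX, I, hI⟩ x = Mrow I x)
    (hΔX : ∀ (l : Fin LX) (I : Finset (Fin nX)) (hI : I ∈ TX.P l.castSucc)
      (J : Finset (Fin nX)), J ∈ TX.P l.succ → I ⊆ J → ∀ x : Fin nX,
      ΔX ⟨l.castSucc, I, hI⟩ x = Mrow I x - Mrow J x)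
    (hΔYroot : ∀ (I : Finset (Fin nY)) (hI : I ∈ TY.P (Fin.last LY)) (y : Fin nY),
      ΔY ⟨Fin.last LY, I, hI⟩ y = Mrow I y)
    (hΔY : ∀ (l : Fin LY) (I : Finset (Fin nY)) (hI : I ∈ TY.P l.castSucc)
      (J : Finset (Fin nY)), J ∈ TY.P l.succ → I ⊆ J → ∀ y : Fin nY,
      ΔY ⟨l.castSucc, I, hI⟩ y = Mrow I y - Mrow J y)
    (Z : Matrix (Fin nX) (Fin nY) ℝ) :
    Z = (Smat TX)ᵀ * (ΔX * Z * ΔYᵀ) * Smat TY := by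
  have hX := SmatT_mul_diff TX ΔX hΔXroot hΔX
  have hY := SmatT_mul_diff TY ΔY hΔYroot hΔY
  have hY' : ΔYᵀ * Smat TY = 1 := by
    have h := congrArg Matrix.transpose hY
    simpa [Matrix.transpose_mul] using h
  calc Z = ((Smat TX)ᵀ * ΔX) * Z * (ΔYᵀ * Smat TY) := by
        rw [hX, hY', Matrix.one_mul, Matrix.mul_one]
    _ = _ := by simp only [Matrix.mul_assoc]
end
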